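/- Let q be an odd prime power, d ≥ 2, and E ⊆ 𝔽_q^d with |E| > (2n/ln 2)·q^{(d+1)/2}. Then C_n ≥ |E|^{n+1}/q^n − (2n/ln 2)·q^{(d+1)/2}·|E|^n/q^n. -/

import Mathlib

/-- `C_n`: the number of unit-distance chains of length `n` in `E ⊆ 𝔽_q^d`, i.e. tuples
`(x^1, …, x^{n+1}) ∈ E^{n+1}` with `‖x^i − x^{i+1}‖ = 1` for `1 ≤ i ≤ n`,
where `‖x‖ = x_1^2 + ⋯ + x_d^2`. -/
def chainCount {F : Type} [Field F] [Fintype F] [DecidableEq F] {d : ℕ}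
    (E : Finset (Fin d → F)) (n : ℕ) : ℕ :=
  (Finset.univ.filter (fun x : Fin (n + 1) → (Fin d → F) =>
    (∀ i, x i ∈ E) ∧ ∀ i : Fin n, ∑ j, (x i.castSucc j - x i.succ j) ^ 2 = 1)).card


open Finset Polynomial in
/-- A nontrivial linear relation among polynomials of small degree. -/
lemma exists_relation {L : Type} [Field L] (R D : ℕ) (hRD : D < R) (f : ℕ → L[X])
    (hf : ∀ r < R, (f r).natDegree < D) :
    ∃ a : ℕ → L, (∃ r < R, a r ≠ 0) ∧ ∑ r ∈ range R, C (a r) * f r = 0 := by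
  classical
  let g : (Fin R → L) →ₗ[L] (Fin D → L) :=
    Fintype.linearCombination L (fun (r : Fin R) => fun d : Fin D => (f r).coeff d)
  have hker : LinearMap.ker g ≠ ⊥ := by
    apply LinearMap.ker_ne_bot_of_finrank_lt
    simpa using hRD
  obtain ⟨a, ha, ha0⟩ := (Submodule.ne_bot_iff _).1 hker
  obtain ⟨r, hr⟩ := Function.ne_iff.1 ha0
  refine ⟨fun i => if h : i < R then a ⟨i, h⟩ else 0, ⟨r, r.2, by simpa using hr⟩, ?_⟩
  rw [Finset.sum_range]
  ext n
  rw [finsetSum_coeff, coeff_zero]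
  simp only [coeff_C_mul, Fin.is_lt, dite_true, Fin.eta]
  by_cases hn : n < D
  · have := congrFun (LinearMap.mem_ker.1 ha) ⟨n, hn⟩
    simpa [g, Fintype.linearCombination_apply] using this
  · apply Finset.sum_eq_zero
    intro i _
    rw [coeff_eq_zero_of_natDegree_lt (by have := hf i i.2; omega), mul_zero]

open Finset Polynomial in
lemma comb_ne_zero {L : Type} [Field L] (R D : ℕ) (e : ℕ → L[X])
    (hm : ∀ r < R, (e r).Monic) (hd : ∀ r < R, (e r).natDegree = D + r)
    (b : ℕ → L) (hb : ∃ r < R, b r ≠ 0) : ∑ r ∈ range R, C (b r) * e r ≠ 0 := by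
  classical
  obtain ⟨r1, hr1, hb1⟩ := hb
  obtain ⟨r0, hr0, hmax⟩ := Finset.exists_max_image ((range R).filter (fun r => b r ≠ 0)) id
    ⟨r1, by simp [hr1, hb1]⟩
  simp only [mem_filter, mem_range, id] at hr0 hmax
  intro h
  have h2 := congrArg (fun p => p.coeff (D + r0)) h
  simp only [finsetSum_coeff, coeff_zero, coeff_C_mul] at h2
  rw [Finset.sum_eq_single r0] at h2
  · rw [← hd r0 hr0.1, (hm r0 hr0.1).coeff_natDegree, mul_one] at h2
    exact hr0.2 h2
  · intro r hr hne
    by_cases hbr : b r = 0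
    · simp [hbr]
    · have := hmax r ⟨by simpa using hr, hbr⟩
      rw [coeff_eq_zero_of_natDegree_lt, mul_zero]
      rw [hd r (by simpa using hr)]
      omega
  · intro h'; simp [hr0.1] at h'

open Finset Polynomial in
/-- The Stepanov method. -/
theorem stepanov {L : Type} [Field L] [Fintype L] (p k q m : ℕ) [Fact p.Prime] [CharP L p]
    (hpk : q = p ^ k) (hq : 2 ≤ q) (hcard : Fintype.card L = q ^ (2 * (m + 1)))
    (c t : L) (hc : c ^ q = c) (S : Finset L)
    (hS : ∀ x ∈ S, x ≠ 0 ∧ ∑ i ∈ range (2 * (m + 1)), (x + c / x) ^ q ^ i = t) :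
    S.card ≤ q ^ (2 * m + 1) + 3 * q ^ (m + 1) := by
  classical
  set u := q ^ m with hu
  set M := q ^ (m + 1) with hM
  have hMu : M = u * q := by rw [hM, hu, pow_succ]
  have hu0 : 0 < u := by positivity
  have hcq : ∀ i, c ^ q ^ i = c := by
    intro i
    induction i with
    | zero => simp
    | succ i ih => rw [pow_succ, pow_mul, ih, hc]
  have hadd : ∀ i (x y : L), (x + y) ^ q ^ i = x ^ q ^ i + y ^ q ^ i := by
    intro i x y
    rw [hpk, ← pow_mul]
    exact add_pow_char_pow x y p _
  have hsum : ∀ i (s : Finset ℕ) (f : ℕ → L), (∑ j ∈ s, f j) ^ q ^ i = ∑ j ∈ s, f j ^ q ^ i := by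
    intro i s f
    rw [hpk, ← pow_mul]
    exact sum_pow_char_pow _ _ _ _
  let H : L[X] := ∑ i ∈ range (m + 1), (X ^ (u + q ^ i) + C c * X ^ (u - q ^ i))
  have hqi : ∀ i, i < m → q ^ i < u := fun i hi => Nat.pow_lt_pow_right (by omega) hi
  have hlow : (C c * X ^ (u - q ^ m) + ∑ i ∈ range m, (X ^ (u + q ^ i) + C c * X ^ (u - q ^ i)) :
      L[X]).degree < (2 * u : ℕ) := by
    refine (degree_add_le _ _).trans_lt (max_lt ?_ ?_)
    · refine (degree_C_mul_X_pow_le _ _).trans_lt ?_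
      exact_mod_cast (by omega)
    · refine (degree_sum_le _ _).trans_lt ?_
      rw [Finset.sup_lt_iff (by exact_mod_cast WithBot.bot_lt_coe _)]
      intro i hi
      have := hqi i (by simpa using hi)
      refine (degree_add_le _ _).trans_lt (max_lt ?_ ?_)
      · rw [degree_X_pow]; exact_mod_cast (by omega)
      · refine (degree_C_mul_X_pow_le _ _).trans_lt ?_
        exact_mod_cast (by omega)
  have hHeq : H = X ^ (2 * u) + (C c * X ^ (u - q ^ m) +
      ∑ i ∈ range m, (X ^ (u + q ^ i) + C c * X ^ (u - q ^ i))) := by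
    simp only [H]
    rw [sum_range_succ, ← hu, two_mul]
    ring
  have hHmonic : H.Monic := by rw [hHeq]; exact monic_X_pow_add hlow
  have hHdeg : H.natDegree = 2 * u := by
    rw [hHeq]
    apply natDegree_eq_of_degree_eq_some
    rw [degree_add_eq_left_of_degree_lt (by rw [degree_X_pow]; exact hlow), degree_X_pow]
  have hHeval : ∀ x : L, x ≠ 0 → H.eval x =
      x ^ u * ∑ i ∈ range (m + 1), (x + c / x) ^ q ^ i := by
    intro x hx
    simp only [H, eval_finsetSum, mul_sum]
    apply sum_congr rfl
    intro i hi
    have hle : q ^ i ≤ u := Nat.pow_le_pow_right (by omega) (by simp at hi; omega)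
    rw [hadd, div_pow, hcq]
    simp only [eval_add, eval_pow, eval_X, eval_mul, eval_C]
    rw [pow_sub₀ x hx hle, pow_add]
    field_simp
  let I := u + 2
  let R := M * I
  let D := M * (u - 1) + I + 2 * u * (q - 1)
  have hRD : D < R := by
    simp only [D, R, I]
    obtain ⟨v, hv⟩ : ∃ v, u = v + 1 := ⟨u - 1, by omega⟩
    obtain ⟨s, hs⟩ : ∃ s, q = s + 2 := ⟨q - 2, by omega⟩
    rw [hMu, hv, hs]
    simp only [Nat.add_sub_cancel]
    rw [show s + 2 - 1 = s + 1 by omega]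
    nlinarith
  let e : ℕ → L[X] := fun r => X ^ (r % u + M * (r / u / q)) * H ^ (r / u % q) *
    X ^ (u * (q - 1 - r / u % q))
  let G : L[X] := C t * X ^ u - H
  let f : ℕ → L[X] := fun r => X ^ (M * (r % u) + (r / u / q)) * G ^ (r / u % q) *
    X ^ (u * (q - 1 - r / u % q))
  have hGdeg : G.natDegree ≤ 2 * u := by
    refine (natDegree_sub_le _ _).trans (max_le ((natDegree_C_mul_X_pow_le _ _).trans (by omega)) hHdeg.le)
  have hj : ∀ r, r / u % q + (q - 1 - r / u % q) = q - 1 := by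
    intro r
    have := Nat.mod_lt (r / u) (show q > 0 by omega)
    omega
  have hem : ∀ r < R, (e r).Monic := fun r _ =>
    ((monic_X_pow _).mul (hHmonic.pow _)).mul (monic_X_pow _)
  have hed : ∀ r < R, (e r).natDegree = u * (q - 1) + r := by
    intro r _
    simp only [e]
    rw [((monic_X_pow _).mul (hHmonic.pow _)).natDegree_mul (monic_X_pow _),
      (monic_X_pow _).natDegree_mul (hHmonic.pow _), natDegree_X_pow, natDegree_X_pow,
      hHmonic.natDegree_pow, hHdeg, hMu]
    have h0 := hj r
    have h1 := Nat.div_add_mod r u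
    have h2 := Nat.div_add_mod (r / u) q
    generalize q - 1 - r / u % q = w at h0 ⊢
    rw [← h0]
    generalize r / u % q = j at *
    generalize r / u / q = i at *
    generalize r / u = z at *
    generalize r % u = y at *
    subst h2
    rw [← h1]
    ring
  have hfd : ∀ r < R, (f r).natDegree < D := by
    intro r hr
    have h1 : r % u ≤ u - 1 := by have := Nat.mod_lt r hu0; omega
    have h2 : r / u / q < I := by
      rw [Nat.div_div_eq_div_mul, ← hMu]
      apply Nat.div_lt_of_lt_mul
      exact hr
    have h3 := hj r
    have h4 : (f r).natDegree ≤ (M * (r % u) + (r / u / q)) + (r / u % q) * (2 * u) +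
        u * (q - 1 - r / u % q) := by
      simp only [f]
      refine natDegree_mul_le.trans (add_le_add (natDegree_mul_le.trans (add_le_add ?_ ?_)) ?_)
      · rw [natDegree_X_pow]
      · exact natDegree_pow_le.trans (Nat.mul_le_mul_left _ hGdeg)
      · rw [natDegree_X_pow]
    refine h4.trans_lt ?_
    simp only [D]
    have h5 : M * (r % u) ≤ M * (u - 1) := Nat.mul_le_mul_left _ h1
    generalize q - 1 - r / u % q = w at h3 ⊢
    rw [← h3]
    generalize r / u % q = j at *
    nlinarith [Nat.zero_le (u * w)]
  obtain ⟨a, ⟨r1, hr1, har1⟩, hrel⟩ := exists_relation R D hRD f hfd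
  let P : L[X] := ∑ r ∈ range R, C (a r ^ M) * e r
  have hP0 : P ≠ 0 := comb_ne_zero R (u * (q - 1)) e hem hed (fun r => a r ^ M)
    ⟨r1, hr1, pow_ne_zero _ har1⟩
  have hPdeg : P.natDegree ≤ u * (q - 1) + R := by
    refine natDegree_sum_le_of_forall_le _ _ ?_
    intro r hr
    refine (natDegree_C_mul_le _ _).trans ?_
    rw [hed r (by simpa using hr)]
    have : r < R := by simpa using hr
    omega
  have hcardM : ∀ x : L, (x ^ M) ^ M = x := by
    intro x
    rw [← pow_mul, hM, ← pow_add, show m + 1 + (m + 1) = 2 * (m + 1) by ring, ← hcard]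
    exact FiniteField.pow_card x
  have hroot : ∀ x ∈ S, P.eval x = 0 := by
    intro x hx
    obtain ⟨hx0, hxt⟩ := hS x hx
    set h := ∑ i ∈ range (m + 1), (x + c / x) ^ q ^ i with hh
    have hhM : h ^ M = t - h := by
      rw [eq_sub_iff_add_eq, ← hxt, two_mul, sum_range_add, add_comm, hM, hsum]
      congr 1
      apply sum_congr rfl
      intro i _
      rw [← pow_mul, ← pow_add, add_comm i]
    have key : ∀ r, x ^ (u * (q - 1)) * (e r).eval x ^ M = x ^ (M * (u * (q - 1))) * (f r).eval x := by
      intro r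
      have e1 : (e r).eval x = x ^ (r % u) * (x ^ M) ^ (r / u / q) * h ^ (r / u % q) *
          x ^ (u * (q - 1)) := by
        simp only [e, eval_mul, eval_pow, eval_X, hHeval x hx0, ← hh]
        conv_rhs => rw [← hj r]
        ring
      have f1 : (f r).eval x = (x ^ (r % u)) ^ M * x ^ (r / u / q) * (t - h) ^ (r / u % q) *
          x ^ (u * (q - 1)) := by
        simp only [f, G, eval_mul, eval_pow, eval_X, eval_sub, eval_C, hHeval x hx0, ← hh]
        conv_rhs => rw [← hj r]
        rw [show t * x ^ u - x ^ u * h = x ^ u * (t - h) by ring, mul_pow]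
        ring
      rw [e1, f1, ← hhM]
      have : ((x ^ M) ^ (r / u / q)) ^ M = x ^ (r / u / q) := by
        rw [← pow_mul, mul_comm, pow_mul, hcardM]
      rw [mul_pow, mul_pow, mul_pow, this]
      ring
    have h1 : x ^ (u * (q - 1)) * P.eval x ^ M = 0 := by
      simp only [P, eval_finsetSum, eval_mul, eval_C]
      rw [hM, hsum, mul_sum]
      have h2 := congrArg (fun z => x ^ (M * (u * (q - 1))) * z.eval x) hrel
      simp only [eval_finsetSum, eval_mul, eval_C, eval_zero, mul_zero, mul_sum] at h2
      rw [← h2]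
      apply sum_congr rfl
      intro r _
      rw [← hM, mul_pow, hcardM, mul_left_comm, key]
      ring
    rcases mul_eq_zero.1 h1 with h2 | h2
    · exact absurd h2 (pow_ne_zero _ hx0)
    · exact pow_eq_zero_iff (by rw [hM]; positivity) |>.1 h2
  have hle : S.card ≤ P.natDegree := by
    have : S ⊆ P.roots.toFinset := by
      intro x hx
      simp [hP0, hroot x hx]
    exact (card_le_card this).trans ((Multiset.toFinset_card_le _).trans (card_roots' _))
  refine hle.trans (hPdeg.trans ?_)
  simp only [R, I]
  have : q ^ (2 * m + 1) = M * u := by rw [hM, hu]; ring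
  rw [this, hMu]
  have : u * (q - 1) ≤ u * q := Nat.mul_le_mul_left _ (by omega)
  nlinarith

open Classical in
/-- Kloosterman sum. -/
noncomputable def kl {F : Type} [Field F] [Fintype F] (ψ : AddChar F ℂ) (c : F) : ℂ :=
  ∑ x : F, if x = 0 then 0 else ψ (x + c / x)

/-- The character `ψ ∘ Tr`. -/
noncomputable def liftChar {F : Type} [Field F] (ψ : AddChar F ℂ) (L : Type) [Field L]
    [Algebra F L] : AddChar L ℂ :=
  ψ.compAddMonoidHom (Algebra.trace F L).toAddMonoidHom

lemma liftChar_apply {F : Type} [Field F] (ψ : AddChar F ℂ) (L : Type) [Field L]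
    [Algebra F L] (x : L) : liftChar ψ L x = ψ (Algebra.trace F L x) := rfl

lemma liftChar_ne_one {F : Type} [Field F] [Fintype F] (ψ : AddChar F ℂ) (hψ : ψ ≠ 1)
    (L : Type) [Field L] [Fintype L] [Algebra F L] : liftChar ψ L ≠ 1 := by
  obtain ⟨a, ha⟩ := AddChar.ne_one_iff.1 hψ
  obtain ⟨b, hb⟩ := Algebra.trace_surjective F L a
  rw [AddChar.ne_one_iff]
  exact ⟨b, by rwa [liftChar_apply, hb]⟩

open Finset in
lemma sum_sq_eq {F : Type} [Field F] [Fintype F] [DecidableEq F] (h2 : ringChar F ≠ 2)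
    (h : F → ℂ) :
    ∑ b, h (b ^ 2) = ∑ v, ((quadraticChar F v : ℂ) + 1) * h v := by
  rw [← Finset.sum_fiberwise (s := univ) (g := fun b : F => b ^ 2) (f := fun b => h (b ^ 2))]
  apply sum_congr rfl
  intro v _
  have h1 := quadraticChar_card_sqrts h2 v
  have h3 : ((({x : F | x ^ 2 = v} : Set F).toFinset.card : ℤ) : ℂ) =
      (quadraticChar F v : ℂ) + 1 := by
    rw [h1]; push_cast; ring
  rw [← h3]
  rw [sum_congr rfl (g := fun _ => h v) (by intro b hb; simp at hb; rw [hb])]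
  rw [sum_const, nsmul_eq_mul]
  congr 1
  push_cast
  congr 2
  ext; simp

open Finset in
lemma sum_sq_add {F : Type} [Field F] [Fintype F] (h2 : ringChar F ≠ 2)
    (δ : F) (hδ : ¬ IsSquare δ) (h : F → ℂ) :
    ∑ b, h (b ^ 2) + ∑ b, h (δ * b ^ 2) = 2 * ∑ v, h v := by
  classical
  have hδ0 : δ ≠ 0 := by rintro rfl; exact hδ (by simp)
  rw [sum_sq_eq h2, sum_sq_eq h2 (fun v => h (δ * v))]
  have : ∑ v, ((quadraticChar F v : ℂ) + 1) * h (δ * v) =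
      ∑ v, (-(quadraticChar F v : ℂ) + 1) * h v := by
    apply Fintype.sum_bijective _ (mulLeft_bijective₀ δ hδ0)
    intro v
    rw [map_mul, quadraticChar_neg_one_iff_not_isSquare.2 hδ]
    push_cast; ring
  rw [this, ← sum_add_distrib, mul_sum]
  apply sum_congr rfl; intros; ring

open Finset in
lemma sum_char_mul {F : Type} [Field F] [Fintype F] [DecidableEq F] (ψ : AddChar F ℂ) (hψ : ψ ≠ 1)
    (a : F) : ∑ s, ψ (s * a) = if a = 0 then (Fintype.card F : ℂ) else 0 := by
  have := AddChar.sum_mulShift a (AddChar.IsPrimitive.of_ne_one hψ)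
  rw [this]; split_ifs <;> simp

open Finset in
lemma kl_zero {F : Type} [Field F] [Fintype F] (ψ : AddChar F ℂ) (hψ : ψ ≠ 1) :
    kl ψ 0 = -1 := by
  classical
  have h := AddChar.sum_eq_zero_of_ne_one hψ
  have : ∑ x, ψ x = kl ψ 0 + ∑ x : F, (if x = 0 then 1 else 0) := by
    rw [kl, ← sum_add_distrib]
    apply sum_congr rfl
    intro x _
    by_cases hx : x = 0 <;> simp [hx]
  rw [h] at this
  simp at this
  linear_combination -this

open Finset in
/-- the sum over trace and norm -/
lemma sum_tn {F : Type} [Field F] [Fintype F] [DecidableEq F] (ψ : AddChar F ℂ) (hψ : ψ ≠ 1)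
    (c : F) (hc : c ≠ 0) :
    ∑ t : F, ∑ N : F, (if N = 0 then 0 else ψ (t + c * t / N)) = Fintype.card F := by
  have h1 : ∀ t : F, ∑ N : F, (if N = 0 then 0 else ψ (t + c * t / N)) =
      ψ t * ((if t = 0 then (Fintype.card F : ℂ) else 0) - 1) := by
    intro t
    have : ∑ N : F, (if N = 0 then 0 else ψ (t + c * t / N)) =
        ∑ N : F, (if N = 0 then 0 else ψ (t + N * (c * t))) := by
      apply Fintype.sum_bijective (fun N : F => N⁻¹) inv_involutive.bijective
      intro N
      simp only [inv_eq_zero]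
      split_ifs with h
      · rfl
      · rw [div_eq_mul_inv, mul_comm (c * t)]
    rw [this]
    have h3 : ∑ N : F, (if N = 0 then 0 else ψ (t + N * (c * t))) =
        ψ t * (∑ N : F, ψ (N * (c * t))) - ∑ N : F, (if N = 0 then ψ t else 0) := by
      rw [mul_sum, ← sum_sub_distrib]
      apply sum_congr rfl
      intro N _
      by_cases hN : N = 0 <;> simp [hN, AddChar.map_add_eq_mul]
    rw [h3, sum_char_mul ψ hψ]
    simp [hc]
    split_ifs <;> ring
  simp_rw [h1, mul_sub, sum_sub_distrib]
  simp [AddChar.sum_eq_zero_of_ne_one hψ]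

open Finset in
/-- The quadratic extension step. -/
lemma kl_quad {F : Type} [Field F] [Fintype F] (h2 : ringChar F ≠ 2) (ψ : AddChar F ℂ)
    (hψ : ψ ≠ 1) (c : F) (hc : c ≠ 0) :
    ∃ (L : Type) (_ : Field L) (_ : Fintype L) (_ : Algebra F L),
      Fintype.card L = Fintype.card F ^ 2 ∧
      kl (liftChar ψ L) (algebraMap F L c) = 2 * (Fintype.card F : ℂ) - kl ψ c ^ 2 := by
  classical
  obtain ⟨δ, hδ⟩ := FiniteField.exists_nonsquare h2
  have h20 : (2 : F) ≠ 0 := Ring.two_ne_zero h2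
  have hfact : Fact (∀ r : F, r ^ 2 ≠ δ + 0 * r) := ⟨by
    intro r hr; exact hδ ⟨r, by rw [← sq, hr]; ring⟩⟩
  let L := QuadraticAlgebra F δ 0
  let _ : Fintype L := Fintype.ofEquiv _ (QuadraticAlgebra.equivProd δ (0 : F)).symm
  have htr : ∀ x : L, Algebra.trace F L x = 2 * x.re := by
    intro x
    rw [Algebra.trace_eq_matrix_trace (QuadraticAlgebra.basis δ (0 : F)), Matrix.trace_fin_two,
      Algebra.leftMulMatrix_eq_repr_mul, Algebra.leftMulMatrix_eq_repr_mul]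
    simp [QuadraticAlgebra.basis]
    ring
  refine ⟨L, inferInstance, inferInstance, inferInstance, ?_, ?_⟩
  · rw [Fintype.ofEquiv_card, Fintype.card_prod, sq]
  let Φ : F → F → ℂ := fun t N => if N = 0 then 0 else ψ (t + c * t / N)
  have hL : kl (liftChar ψ L) (algebraMap F L c) = ∑ a : F, ∑ b : F, Φ (2 * a) (a ^ 2 - δ * b ^ 2) := by
    rw [kl, ← Fintype.sum_prod_type' (f := fun a b => Φ (2 * a) (a ^ 2 - δ * b ^ 2))]
    apply Fintype.sum_equiv (QuadraticAlgebra.equivProd δ (0 : F))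
    intro x
    have hn : QuadraticAlgebra.norm x = x.re ^ 2 - δ * x.im ^ 2 := by
      rw [QuadraticAlgebra.norm_def]; ring
    have hn0 : x = 0 ↔ x.re ^ 2 - δ * x.im ^ 2 = 0 := by
      rw [← hn, QuadraticAlgebra.norm_eq_zero_iff_eq_zero]
    simp only [Φ, QuadraticAlgebra.equivProd, Equiv.coe_fn_mk, ← hn0]
    by_cases hx : x = 0
    · simp [hx]
    · rw [if_neg hx, if_neg hx, liftChar_apply, htr, div_eq_mul_inv]
      congr 1
      rw [QuadraticAlgebra.re_add, QuadraticAlgebra.re_mul]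
      have hre : (algebraMap F L c).re = c := rfl
      have him : (algebraMap F L c).im = 0 := rfl
      rw [hre, him]
      have : (x⁻¹ : L).re = (QuadraticAlgebra.norm x)⁻¹ * x.re := by
        rw [QuadraticAlgebra.inv_def]; simp
      rw [this, hn, div_eq_mul_inv]
      ring
  have hF : kl ψ c ^ 2 = ∑ a : F, ∑ b : F, Φ (2 * a) (a ^ 2 - b ^ 2) := by
    rw [kl, sq, sum_mul_sum, ← Fintype.sum_prod_type' (f := fun a b => Φ (2 * a) (a ^ 2 - b ^ 2)),
      ← Fintype.sum_prod_type' (f := fun x y : F => (if x = 0 then 0 else ψ (x + c / x)) *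
        (if y = 0 then 0 else ψ (y + c / y)))]
    symm
    refine Fintype.sum_equiv
      ⟨fun z => (z.1 + z.2, z.1 - z.2), fun z => ((z.1 + z.2) / 2, (z.1 - z.2) / 2), ?_, ?_⟩ _ _ ?_
    · intro z; ext <;> simp <;> field_simp <;> ring
    · intro z; ext <;> simp <;> field_simp <;> ring
    · rintro ⟨a, b⟩
      simp only [Φ, Equiv.coe_fn_mk]
      rw [show a ^ 2 - b ^ 2 = (a + b) * (a - b) by ring]
      by_cases h1 : a + b = 0
      · simp [h1]
      by_cases h3 : a - b = 0
      · simp [h3]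
      rw [if_neg h1, if_neg h3, if_neg (mul_ne_zero h1 h3), ← AddChar.map_add_eq_mul]
      congr 1
      field_simp
      ring
  have hsum : kl (liftChar ψ L) (algebraMap F L c) + kl ψ c ^ 2 = 2 * (Fintype.card F : ℂ) := by
    rw [hL, hF, ← sum_tn ψ hψ c hc, add_comm, ← sum_add_distrib]
    have : ∀ a : F, ∑ b : F, Φ (2 * a) (a ^ 2 - b ^ 2) + ∑ b : F, Φ (2 * a) (a ^ 2 - δ * b ^ 2) =
        2 * ∑ N : F, Φ (2 * a) N := by
      intro a
      rw [sum_sq_add h2 δ hδ (fun v => Φ (2 * a) (a ^ 2 - v))]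
      congr 1
      exact Fintype.sum_equiv (Equiv.subLeft (a ^ 2)) _ _ (fun v => rfl)
    simp_rw [this, ← mul_sum]
    congr 1
    exact Fintype.sum_bijective _ (mulLeft_bijective₀ (2 : F) h20) _ _ (fun a => rfl)
  linear_combination hsum

lemma liftChar_liftChar {F L L' : Type} [Field F] [Field L] [Field L'] [Fintype F] [Fintype L]
    [Fintype L'] [Algebra F L] [Algebra L L'] [Algebra F L'] [IsScalarTower F L L']
    (ψ : AddChar F ℂ) : liftChar (liftChar ψ L) L' = liftChar ψ L' := by
  ext x
  simp only [liftChar_apply]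
  rw [Algebra.trace_trace]

lemma kl_iter {F : Type} [Field F] [Fintype F] (h2 : ringChar F ≠ 2) (ψ : AddChar F ℂ)
    (hψ : ψ ≠ 1) (c : F) (hc : c ≠ 0) (δ : ℝ) (hδ : 0 ≤ δ)
    (hK : (2 + δ) * √(Fintype.card F : ℝ) ≤ ‖kl ψ c‖) (k : ℕ) :
    ∃ (L : Type) (_ : Field L) (_ : Fintype L) (_ : Algebra F L),
      Fintype.card L = Fintype.card F ^ (2 ^ k) ∧
      (2 + 4 ^ k * δ) * √(Fintype.card L : ℝ) ≤ ‖kl (liftChar ψ L) (algebraMap F L c)‖ := by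
  induction k with
  | zero =>
    refine ⟨F, inferInstance, inferInstance, inferInstance, by simp, ?_⟩
    have : liftChar ψ F = ψ := by
      ext x; simp [liftChar_apply]
    rw [this]
    simpa using hK
  | succ k ih =>
    obtain ⟨L, i1, i2, i3, hcard, hb⟩ := ih
    have hch : ringChar L ≠ 2 := by
      rw [← Algebra.ringChar_eq F L]; exact h2
    obtain ⟨L', j1, j2, j3, hcard', hb'⟩ := kl_quad hch (liftChar ψ L) (liftChar_ne_one ψ hψ L)
      (algebraMap F L c) (by simpa using hc)
    let _ : Algebra F L' := ((algebraMap L L').comp (algebraMap F L)).toAlgebra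
    have : IsScalarTower F L L' := IsScalarTower.of_algebraMap_eq (fun _ => rfl)
    refine ⟨L', j1, j2, inferInstance, ?_, ?_⟩
    · rw [hcard', hcard, ← pow_mul, ← pow_succ]
    · rw [liftChar_liftChar] at hb'
      have : algebraMap F L' c = algebraMap L L' (algebraMap F L c) := rfl
      rw [this, hb', hcard']
      set Q : ℝ := (Fintype.card L : ℝ) with hQ
      have hQ0 : 0 ≤ Q := by positivity
      have e1 : √((Fintype.card L ^ 2 : ℕ) : ℝ) = Q := by
        push_cast; exact Real.sqrt_sq hQ0
      rw [e1]
      have e2 : ‖kl (liftChar ψ L) (algebraMap F L c)‖ ^ 2 ≤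
          ‖2 * (Fintype.card L : ℂ) - kl (liftChar ψ L) (algebraMap F L c) ^ 2‖ + 2 * Q := by
        rw [← norm_pow]
        have := norm_sub_norm_le (kl (liftChar ψ L) (algebraMap F L c) ^ 2) (2 * (Fintype.card L : ℂ))
        rw [norm_sub_rev] at this
        have e3 : ‖2 * (Fintype.card L : ℂ)‖ = 2 * Q := by simp [hQ]
        linarith
      have e4 : ((2 + 4 ^ k * δ) * √Q) ^ 2 ≤ ‖kl (liftChar ψ L) (algebraMap F L c)‖ ^ 2 := by
        gcongr
      rw [mul_pow, Real.sq_sqrt hQ0] at e4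
      have e5 : 0 ≤ (4 ^ k * δ) ^ 2 * Q := by positivity
      rw [pow_succ]
      nlinarith

open Finset in
lemma kl_bound {F : Type} [Field F] [Fintype F] (ψ : AddChar F ℂ)
    (hψ : ψ ≠ 1) (c : F) (L : Type) [Field L] [Fintype L] [Algebra F L] (m : ℕ)
    (hcard : Fintype.card L = Fintype.card F ^ (2 * (m + 1))) :
    ‖kl (liftChar ψ L) (algebraMap F L c)‖ ≤
      3 * (Fintype.card F : ℝ) ^ 2 * √(Fintype.card L : ℝ) := by
  classical
  set q := Fintype.card F with hq
  have hq2 : 2 ≤ q := Fintype.one_lt_card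
  obtain ⟨p, hcp, k, hp, hpk⟩ := FiniteField.card' F
  have : Fact p.Prime := ⟨hp⟩
  have : CharP L p := charP_of_injective_algebraMap (algebraMap F L).injective p
  have hfr : Module.finrank F L = 2 * (m + 1) := by
    have := Module.card_eq_pow_finrank (K := F) (V := L)
    rw [hcard] at this
    exact (Nat.pow_right_injective hq2 this).symm
  let S : F → Finset L := fun t => univ.filter (fun x => x ≠ 0 ∧
    Algebra.trace F L (x + algebraMap F L c / x) = t)
  have hS : ∀ t, (S t).card ≤ q ^ (2 * m + 1) + 3 * q ^ (m + 1) := by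
    intro t
    apply stepanov p k q m hpk hq2 hcard (algebraMap F L c) (algebraMap F L t)
    · rw [← map_pow, hq, FiniteField.pow_card]
    · intro x hx
      simp only [S, mem_filter, mem_univ, true_and] at hx
      refine ⟨hx.1, ?_⟩
      rw [← hx.2, FiniteField.algebraMap_trace_eq_sum_pow, hfr, Nat.card_eq_fintype_card]
  have hkl : kl (liftChar ψ L) (algebraMap F L c) = ∑ t, ((S t).card : ℂ) * ψ t := by
    rw [kl, ← Finset.sum_fiberwise (s := univ)
      (g := fun x : L => Algebra.trace F L (x + algebraMap F L c / x))]
    apply sum_congr rfl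
    intro t _
    rw [← nsmul_eq_mul, ← sum_const, sum_filter, sum_filter]
    apply sum_congr rfl
    intro x _
    by_cases h0 : x = 0
    · simp [h0]
    · by_cases h1 : Algebra.trace F L (x + algebraMap F L c / x) = t
      · simp only [h0, h1, if_true, if_false, ne_eq, not_false_eq_true, and_self]
        rw [liftChar_apply, h1]
      · simp only [h1, if_false, and_false]
  have htot : ∑ t, (S t).card + 1 = q ^ (2 * (m + 1)) := by
    have h1 := card_eq_sum_card_fiberwise (s := univ.filter (fun x : L => x ≠ 0)) (t := univ)
      (f := fun x : L => Algebra.trace F L (x + algebraMap F L c / x)) (by simp)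
    simp only [filter_filter] at h1
    have h2 : (univ.filter (fun x : L => x ≠ 0)).card + 1 = Fintype.card L := by
      rw [filter_ne', card_erase_of_mem (mem_univ _), card_univ]
      have : 0 < Fintype.card L := Fintype.card_pos
      omega
    rw [← hcard, ← h2, h1]
  have hq1 : (2 : ℝ) ≤ q := by exact_mod_cast hq2
  set A : ℝ := (q : ℝ) ^ (2 * m + 1) with hA
  set M : ℝ := (q : ℝ) ^ (m + 1) with hM
  have hM1 : 1 ≤ M := one_le_pow₀ (by linarith)
  have hsq : √(Fintype.card L : ℝ) = M := by
    rw [hcard]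
    push_cast
    rw [show (q : ℝ) ^ (2 * (m + 1)) = M ^ 2 by rw [hM]; ring]
    exact Real.sqrt_sq (by linarith)
  have hup : ∀ t, ((S t).card : ℝ) ≤ A + 3 * M := by
    intro t
    have := hS t
    rw [hA, hM]
    exact_mod_cast this
  have htot' : ∑ t, ((S t).card : ℝ) = q * A - 1 := by
    have : ((∑ t, (S t).card + 1 : ℕ) : ℝ) = ((q ^ (2 * (m + 1)) : ℕ) : ℝ) := by rw [htot]
    push_cast at this
    rw [hA]
    linear_combination this
  have hlo : ∀ t, A - 3 * q * M ≤ ((S t).card : ℝ) := by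
    intro t
    have h1 : A + 3 * M - ((S t).card : ℝ) ≤ ∑ s, (A + 3 * M - ((S s).card : ℝ)) :=
      single_le_sum (f := fun s => A + 3 * M - ((S s).card : ℝ))
        (fun s _ => by have := hup s; linarith) (mem_univ t)
    rw [sum_sub_distrib, htot', sum_const, card_univ, ← hq, nsmul_eq_mul] at h1
    nlinarith
  have habs : ∀ t, |((S t).card : ℝ) - A| ≤ 3 * q * M := by
    intro t
    rw [abs_le]
    have h1 := hup t
    have h2 := hlo t
    constructor <;> nlinarith
  have hkl2 : kl (liftChar ψ L) (algebraMap F L c) =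
      ∑ t, ((((S t).card : ℝ) - A : ℝ) : ℂ) * ψ t := by
    rw [hkl]
    push_cast
    simp_rw [sub_mul, sum_sub_distrib, ← mul_sum, AddChar.sum_eq_zero_of_ne_one hψ]
    simp
  rw [hkl2, hsq]
  refine (norm_sum_le _ _).trans ?_
  have : ∀ t ∈ (univ : Finset F), ‖((((S t).card : ℝ) - A : ℝ) : ℂ) * ψ t‖ ≤ 3 * q * M := by
    intro t _
    rw [norm_mul, AddChar.norm_apply, mul_one, Complex.norm_real]
    exact habs t
  refine (sum_le_card_nsmul _ _ _ this).trans ?_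
  rw [card_univ, ← hq, nsmul_eq_mul]
  apply le_of_eq
  ring

/-- The Weil bound for Kloosterman sums. -/
theorem weil_kl {F : Type} [Field F] [Fintype F] (h2 : ringChar F ≠ 2) (ψ : AddChar F ℂ)
    (hψ : ψ ≠ 1) (c : F) : ‖kl ψ c‖ ≤ 2 * √(Fintype.card F : ℝ) := by
  have hq2 : 2 ≤ Fintype.card F := Fintype.one_lt_card
  have hs : 0 < √(Fintype.card F : ℝ) := Real.sqrt_pos.2 (by exact_mod_cast (by omega))
  by_cases hc : c = 0
  · rw [hc, kl_zero ψ hψ, norm_neg, norm_one]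
    have : (1 : ℝ) ≤ √(Fintype.card F : ℝ) := by
      rw [Real.one_le_sqrt]; exact_mod_cast (by omega)
    linarith
  by_contra! hcon
  obtain ⟨δ, hδ, hδ2⟩ : ∃ δ : ℝ, 0 < δ ∧ (2 + δ) * √(Fintype.card F : ℝ) ≤ ‖kl ψ c‖ := by
    refine ⟨‖kl ψ c‖ / √(Fintype.card F : ℝ) - 2, ?_, ?_⟩
    · rw [sub_pos, lt_div_iff₀ hs]; exact hcon
    · apply le_of_eq
      field_simp
      ring
  obtain ⟨k, hk⟩ := pow_unbounded_of_one_lt (3 * (Fintype.card F : ℝ) ^ 2 / δ)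
    (show (1 : ℝ) < 4 by norm_num)
  obtain ⟨L, i1, i2, i3, hcard, hb⟩ := kl_iter h2 ψ hψ c hc δ hδ.le hδ2 (k + 1)
  obtain ⟨m, hm⟩ : ∃ m, 2 ^ k = m + 1 := ⟨2 ^ k - 1, by have := Nat.one_le_two_pow (n := k); omega⟩
  have hb2 := kl_bound ψ hψ c L m (by rw [hcard, pow_succ, mul_comm, hm])
  have hsL : 0 < √(Fintype.card L : ℝ) := Real.sqrt_pos.2 (by exact_mod_cast Fintype.card_pos)
  have h3 := le_of_mul_le_mul_right (hb.trans hb2) hsL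
  rw [div_lt_iff₀ hδ] at hk
  have : (0 : ℝ) < 4 ^ k * δ := by positivity
  rw [pow_succ] at h3
  linarith

/-- quadratic Gauss sum -/
noncomputable def gs {F : Type} [Field F] [Fintype F] (ψ : AddChar F ℂ) (s : F) : ℂ :=
  ∑ x : F, ψ (s * x ^ 2)

lemma gs_eq {F : Type} [Field F] [Fintype F] [DecidableEq F] (h2 : ringChar F ≠ 2)
    (ψ : AddChar F ℂ) (hψ : ψ ≠ 1) (s : F) (hs : s ≠ 0) :
    gs ψ s = (quadraticChar F s : ℂ) * gs ψ 1 := by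
  have key : ∀ s : F, s ≠ 0 → gs ψ s = ∑ v, (quadraticChar F v : ℂ) * ψ (s * v) := by
    intro s hs
    rw [gs, sum_sq_eq h2 (fun v => ψ (s * v))]
    simp_rw [add_mul, one_mul, Finset.sum_add_distrib]
    have := sum_char_mul ψ hψ s
    simp_rw [mul_comm s, this, if_neg hs, add_zero]
  rw [key s hs, key 1 one_ne_zero, Finset.mul_sum]
  apply Fintype.sum_bijective _ (mulLeft_bijective₀ s hs)
  intro v
  have h1 : quadraticChar F s * quadraticChar F (s * v) = quadraticChar F v := by
    rw [map_mul, ← mul_assoc, ← sq, quadraticChar_sq_one hs, one_mul]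
  rw [one_mul, ← mul_assoc, ← Int.cast_mul, h1]

lemma gs_norm {F : Type} [Field F] [Fintype F] (h2 : ringChar F ≠ 2)
    (ψ : AddChar F ℂ) (hψ : ψ ≠ 1) : ‖gs ψ 1‖ = √(Fintype.card F : ℝ) := by
  classical
  let χ : MulChar F ℂ := (quadraticChar F).ringHomComp (Int.castRingHom ℂ)
  have h1 : gs ψ 1 = gaussSum χ ψ := by
    rw [gs]
    simp_rw [one_mul]
    rw [sum_sq_eq h2 (fun v => ψ v)]
    simp_rw [add_mul, one_mul, Finset.sum_add_distrib]
    rw [AddChar.sum_eq_zero_of_ne_one hψ, add_zero]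
    rfl
  have hχ : χ ≠ 1 := by
    obtain ⟨a, ha⟩ := quadraticChar_exists_neg_one' h2
    intro h
    have := congrArg (fun f : MulChar F ℂ => f a) h
    simp [χ, ha, MulChar.ringHomComp_apply, MulChar.one_apply_coe] at this
    norm_num at this
  have hχ2 : χ.IsQuadratic := (quadraticChar_isQuadratic F).comp _
  have h3 := gaussSum_sq hχ hχ2 (AddChar.IsPrimitive.of_ne_one hψ)
  have h4 : ‖χ (-1)‖ = 1 := by
    have : (-1 : F) ≠ 0 := by simp
    rcases quadraticChar_dichotomy this with h | h <;> simp [χ, MulChar.ringHomComp_apply, h]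
  have h5 : ‖gs ψ 1‖ ^ 2 = Fintype.card F := by
    rw [h1, ← norm_pow, h3, norm_mul, h4]; simp
  rw [← h5, Real.sqrt_sq (norm_nonneg _)]

lemma gs_shift {F : Type} [Field F] [Fintype F] (h2 : ringChar F ≠ 2)
    (ψ : AddChar F ℂ) (s m : F) (hs : s ≠ 0) :
    ∑ x, ψ (s * x ^ 2 + m * x) = ψ (-(m ^ 2 / 4 / s)) * gs ψ s := by
  have h20 : (2 : F) ≠ 0 := Ring.two_ne_zero h2
  have h40 : (4 : F) ≠ 0 := by
    rw [show (4 : F) = 2 * 2 by norm_num]; exact mul_ne_zero h20 h20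
  rw [gs, Finset.mul_sum]
  refine Fintype.sum_equiv (Equiv.addRight (m / 2 / s)) _ _ ?_
  intro x
  rw [← AddChar.map_add_eq_mul]
  congr 1
  simp only [Equiv.coe_addRight]
  have : m / 2 / s = m / (2 * s) := by rw [div_div]
  field_simp
  ring

open Classical in
/-- Twisted (Salié) sum, with an exponent on the quadratic character. -/
noncomputable def tw {F : Type} [Field F] [Fintype F] (ψ : AddChar F ℂ) (d : ℕ) (c : F) : ℂ :=
  ∑ s : F, if s = 0 then 0 else (quadraticChar F s : ℂ) ^ d * ψ (s + c / s)

lemma salie_bound {F : Type} [Field F] [Fintype F] (h2 : ringChar F ≠ 2) (ψ : AddChar F ℂ)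
    (hψ : ψ ≠ 1) (c : F) : ‖tw ψ 1 c‖ ≤ 2 * √(Fintype.card F : ℝ) := by
  classical
  by_cases hc : IsSquare c
  · obtain ⟨r, hr⟩ := hc
    have hq0 : (0 : ℝ) < Fintype.card F := by exact_mod_cast Fintype.card_pos
    have h20 : (2 : F) ≠ 0 := Ring.two_ne_zero h2
    have e1 : ∀ s : F, s ≠ 0 → (quadraticChar F s : ℂ) * ψ (s + c / s) *
        ((quadraticChar F (-1) : ℂ) * gs ψ 1) = ∑ x, ψ (-(2 * r) * x) * ψ (s * (1 - x ^ 2)) := by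
      intro s hs
      have h3 := gs_shift h2 ψ (-s) (-(2 * r)) (neg_ne_zero.2 hs)
      rw [gs_eq h2 ψ hψ (-s) (neg_ne_zero.2 hs), neg_eq_neg_one_mul s, map_mul] at h3
      have h4 : ∑ x, ψ (-(2 * r) * x) * ψ (s * (1 - x ^ 2)) =
          ψ s * ∑ x, ψ (-1 * s * x ^ 2 + -(2 * r) * x) := by
        rw [Finset.mul_sum]
        apply Finset.sum_congr rfl
        intro x _
        rw [← AddChar.map_add_eq_mul, ← AddChar.map_add_eq_mul]
        congr 1; ring
      rw [h4, h3, AddChar.map_add_eq_mul]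
      have : c / s = -((-(2 * r)) ^ 2 / 4 / (-1 * s)) := by
        have h40 : (4 : F) ≠ 0 := by
          rw [show (4 : F) = 2 * 2 by norm_num]; exact mul_ne_zero h20 h20
        rw [hr]; field_simp; ring
      rw [← this]
      push_cast
      ring
    have e2 : tw ψ 1 c * ((quadraticChar F (-1) : ℂ) * gs ψ 1) =
        ∑ x, ψ (-(2 * r) * x) * ((if 1 - x ^ 2 = 0 then (Fintype.card F : ℂ) else 0) - 1) := by
      have : tw ψ 1 c * ((quadraticChar F (-1) : ℂ) * gs ψ 1) =
          ∑ s, (if s = 0 then 0 else ∑ x, ψ (-(2 * r) * x) * ψ (s * (1 - x ^ 2))) := by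
        rw [tw, Finset.sum_mul]
        apply Finset.sum_congr rfl
        intro s _
        by_cases hs : s = 0
        · simp [hs]
        · rw [if_neg hs, if_neg hs, ← e1 s hs, pow_one]
      rw [this]
      have h5 : ∀ s : F, (if s = 0 then 0 else ∑ x, ψ (-(2 * r) * x) * ψ (s * (1 - x ^ 2))) =
          ∑ x, ψ (-(2 * r) * x) * (ψ (s * (1 - x ^ 2)) - if s = 0 then 1 else 0) := by
        intro s
        by_cases hs : s = 0 <;> simp [hs]
      simp_rw [h5]
      rw [Finset.sum_comm]
      apply Finset.sum_congr rfl
      intro x _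
      rw [← Finset.mul_sum, Finset.sum_sub_distrib, sum_char_mul ψ hψ]
      simp
    have e3 : ‖tw ψ 1 c‖ * √(Fintype.card F : ℝ) ≤ 2 * Fintype.card F := by
      have h6 : ‖(quadraticChar F (-1) : ℂ)‖ = 1 := by
        have : (-1 : F) ≠ 0 := by simp
        rcases quadraticChar_dichotomy this with h | h <;> simp [h]
      have h7 := congrArg norm e2
      rw [norm_mul, norm_mul, h6, one_mul, gs_norm h2 ψ hψ] at h7
      rw [h7]
      have h8 : ∑ x, ψ (-(2 * r) * x) * ((if 1 - x ^ 2 = 0 then (Fintype.card F : ℂ) else 0) - 1) =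
          Fintype.card F * (ψ (2 * r) + ψ (-(2 * r))) - (if r = 0 then (Fintype.card F : ℂ) else 0) := by
        simp_rw [mul_sub, Finset.sum_sub_distrib, mul_one]
        congr 1
        · have hx : ∀ x : F, (1 - x ^ 2 = 0) ↔ (x = 1 ∨ x = -1) := by
            intro x
            rw [sub_eq_zero, eq_comm, sq_eq_one_iff]
          have hne : (1 : F) ≠ -1 := by
            intro h
            apply h20
            linear_combination h
          have : ∀ x : F, ψ (-(2 * r) * x) * (if 1 - x ^ 2 = 0 then (Fintype.card F : ℂ) else 0) =
              (if x = 1 then ψ (-(2 * r)) * Fintype.card F else 0) +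
              (if x = -1 then ψ (2 * r) * Fintype.card F else 0) := by
            intro x
            simp only [hx]
            by_cases h1 : x = 1
            · simp [h1, hne]
            · by_cases h3 : x = -1 <;> simp [h1, h3, hne.symm]
          simp_rw [this, Finset.sum_add_distrib]
          simp
          ring
        · simp_rw [mul_comm _ (_ : F)]
          rw [sum_char_mul ψ hψ]
          simp [h20]
      rw [h8]
      by_cases hr0 : r = 0
      · simp [hr0]
        rw [show (Fintype.card F : ℂ) * (1 + 1) - Fintype.card F = Fintype.card F by ring]
        simp only [Complex.norm_natCast]
        linarith
      · rw [if_neg hr0, sub_zero, norm_mul]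
        have := norm_add_le (ψ (2 * r)) (ψ (-(2 * r)))
        rw [AddChar.norm_apply, AddChar.norm_apply] at this
        simp only [Complex.norm_natCast]
        nlinarith
    have h9 : 0 < √(Fintype.card F : ℝ) := Real.sqrt_pos.2 hq0
    have h10 : √(Fintype.card F : ℝ) * √(Fintype.card F : ℝ) = Fintype.card F :=
      Real.mul_self_sqrt hq0.le
    nlinarith
  · have hc0 : c ≠ 0 := by rintro rfl; exact hc (by simp)
    have : tw ψ 1 c = -tw ψ 1 c := by
      conv_rhs => rw [tw, ← Finset.sum_neg_distrib]
      rw [tw]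
      have hinv : Function.Involutive (fun s : F => c / s) := by
        intro s
        simp only
        rw [div_div_cancel₀ hc0]
      apply Fintype.sum_bijective _ hinv.bijective
      intro s
      by_cases hs : s = 0
      · simp [hs]
      · have : c / s ≠ 0 := div_ne_zero hc0 hs
        rw [if_neg hs, if_neg this, pow_one, pow_one, div_div_cancel₀ hc0, add_comm]
        have hq : quadraticChar F (c / s) = - quadraticChar F s := by
          have h1 : quadraticChar F c = -1 := quadraticChar_neg_one_iff_not_isSquare.2 hc
          have h3 : quadraticChar F (c / s) * quadraticChar F s = -1 := by
            rw [← map_mul, div_mul_cancel₀ _ hs, h1]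
          rcases quadraticChar_dichotomy hs with h | h <;> rw [h] at h3 ⊢ <;> linarith
        rw [hq]; push_cast; ring
    have h0 : tw ψ 1 c = 0 := by
      have h3 : (2 : ℂ) * tw ψ 1 c = 0 := by linear_combination this
      simpa using h3
    rw [h0, norm_zero]; positivity

lemma tw_bound {F : Type} [Field F] [Fintype F] (h2 : ringChar F ≠ 2) (ψ : AddChar F ℂ)
    (hψ : ψ ≠ 1) (d : ℕ) (c : F) : ‖tw ψ d c‖ ≤ 2 * √(Fintype.card F : ℝ) := by
  classical
  have hsq : ∀ s : F, s ≠ 0 → (quadraticChar F s : ℂ) ^ 2 = 1 := by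
    intro s hs
    rw [← Int.cast_pow, quadraticChar_sq_one hs, Int.cast_one]
  rcases Nat.even_or_odd' d with ⟨k, hk | hk⟩
  · have : tw ψ d c = kl ψ c := by
      rw [tw, kl]
      apply Finset.sum_congr rfl
      intro s _
      by_cases hs : s = 0
      · simp [hs]
      · rw [if_neg hs, if_neg hs, hk, pow_mul, hsq s hs, one_pow, one_mul]
    rw [this]
    exact weil_kl h2 ψ hψ c
  · have : tw ψ d c = tw ψ 1 c := by
      rw [tw, tw]
      apply Finset.sum_congr rfl
      intro s _
      by_cases hs : s = 0
      · simp [hs]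
      · rw [if_neg hs, if_neg hs, hk, pow_succ, pow_mul, hsq s hs, one_pow, one_mul, pow_one]
    rw [this]
    exact salie_bound h2 ψ hψ c

lemma psi_sum {F : Type} [Field F] (ψ : AddChar F ℂ) {d : ℕ} (g : Fin d → F) :
    ψ (∑ j, g j) = ∏ j, ψ (g j) := by
  have : ∀ s : Finset (Fin d), ψ (∑ j ∈ s, g j) = ∏ j ∈ s, ψ (g j) := by
    intro s
    induction s using Finset.induction_on with
    | empty => simp
    | insert a s ha ih => rw [Finset.sum_insert ha, Finset.prod_insert ha, AddChar.map_add_eq_mul, ih]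
  exact this _

lemma dot_ortho {F : Type} [Field F] [Fintype F] [DecidableEq F] (ψ : AddChar F ℂ) (hψ : ψ ≠ 1)
    {d : ℕ} (z : Fin d → F) :
    ∑ m : Fin d → F, ψ (∑ j, m j * z j) = if z = 0 then (Fintype.card F : ℂ) ^ d else 0 := by
  have h1 : ∏ j, ∑ a, ψ (a * z j) = ∑ m : Fin d → F, ψ (∑ j, m j * z j) := by
    rw [Finset.prod_univ_sum, Fintype.piFinset_univ]
    apply Finset.sum_congr rfl
    intro m _
    rw [psi_sum]
  rw [← h1]
  simp_rw [sum_char_mul ψ hψ]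
  split_ifs with h
  · simp [h]
  · obtain ⟨j, hj⟩ := Function.ne_iff.1 h
    exact Finset.prod_eq_zero (Finset.mem_univ j) (by simpa using hj)

/-- centred indicator of the unit sphere -/
noncomputable def bf {F : Type} [Field F] [Fintype F] [DecidableEq F] {d : ℕ} (z : Fin d → F) : ℝ :=
  (if ∑ j, z j ^ 2 = 1 then 1 else 0) - 1 / (Fintype.card F : ℝ)

/-- its Fourier transform -/
noncomputable def bh {F : Type} [Field F] [Fintype F] [DecidableEq F] (ψ : AddChar F ℂ)
    {d : ℕ} (m : Fin d → F) : ℂ :=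
  ∑ z : Fin d → F, (bf z : ℂ) * ψ (∑ j, m j * z j)

lemma bf_eq {F : Type} [Field F] [Fintype F] [DecidableEq F] (ψ : AddChar F ℂ) (hψ : ψ ≠ 1)
    {d : ℕ} (z : Fin d → F) :
    (Fintype.card F : ℂ) * (bf z : ℂ) = ∑ s : F, if s = 0 then 0 else ψ (s * (∑ j, z j ^ 2 - 1)) := by
  have hq : (Fintype.card F : ℂ) ≠ 0 := by exact_mod_cast Fintype.card_ne_zero
  have h1 : ∑ s : F, (if s = 0 then 0 else ψ (s * (∑ j, z j ^ 2 - 1))) =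
      ∑ s : F, ψ (s * (∑ j, z j ^ 2 - 1)) - ∑ s : F, (if s = 0 then 1 else 0) := by
    rw [← Finset.sum_sub_distrib]
    apply Finset.sum_congr rfl
    intro s _
    by_cases hs : s = 0 <;> simp [hs]
  rw [h1, sum_char_mul ψ hψ, bf]
  simp only [sub_eq_zero]
  push_cast
  split_ifs <;> simp <;> field_simp

lemma bh_eq {F : Type} [Field F] [Fintype F] [DecidableEq F] (h2 : ringChar F ≠ 2)
    (ψ : AddChar F ℂ) (hψ : ψ ≠ 1) {d : ℕ} (m : Fin d → F) :
    (Fintype.card F : ℂ) * bh ψ m = gs ψ 1 ^ d * tw ψ⁻¹ d ((∑ j, m j ^ 2) / 4) := by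
  rw [bh, Finset.mul_sum]
  simp_rw [← mul_assoc, bf_eq ψ hψ, Finset.sum_mul]
  rw [Finset.sum_comm, tw, Finset.mul_sum]
  apply Finset.sum_congr rfl
  intro s _
  by_cases hs : s = 0
  · simp [hs]
  simp only [if_neg hs]
  have h1 : ∏ j, ∑ a, ψ (s * a ^ 2 + m j * a) =
      ∑ z : Fin d → F, ψ (∑ j, (s * z j ^ 2 + m j * z j)) := by
    rw [Finset.prod_univ_sum, Fintype.piFinset_univ]
    apply Finset.sum_congr rfl
    intro m _
    rw [psi_sum]
  have h3 : ∑ z : Fin d → F, ψ (s * (∑ j, z j ^ 2 - 1)) * ψ (∑ j, m j * z j) =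
      ψ (-s) * ∏ j, ∑ a, ψ (s * a ^ 2 + m j * a) := by
    rw [h1, Finset.mul_sum]
    apply Finset.sum_congr rfl
    intro z _
    rw [← AddChar.map_add_eq_mul, ← AddChar.map_add_eq_mul, Finset.sum_add_distrib, ← Finset.mul_sum]
    congr 1; ring
  rw [h3]
  simp_rw [gs_shift h2 ψ s _ hs]
  rw [Finset.prod_mul_distrib, ← psi_sum, Finset.prod_const, Finset.card_univ,
    Fintype.card_fin, gs_eq h2 ψ hψ s hs, AddChar.inv_apply]
  have : -(s + (∑ j, m j ^ 2) / 4 / s) = -s + ∑ j, -(m j ^ 2 / 4 / s) := by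
    rw [Finset.sum_neg_distrib, Finset.sum_div, Finset.sum_div]; ring
  rw [this, AddChar.map_add_eq_mul, mul_pow]
  have hqc : ∀ (i1 i2 : DecidableEq F), @quadraticChar F _ _ i1 = @quadraticChar F _ _ i2 := by
    intro i1 i2; rw [Subsingleton.elim i1 i2]
  simp only [hqc _ (Classical.decEq F)]
  ring

lemma bh_bound {F : Type} [Field F] [Fintype F] [DecidableEq F] (h2 : ringChar F ≠ 2)
    (ψ : AddChar F ℂ) (hψ : ψ ≠ 1) {d : ℕ} (m : Fin d → F) :
    ‖bh ψ m‖ ≤ 2 * √(Fintype.card F : ℝ) ^ (d + 1) / Fintype.card F := by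
  have hq0 : (0 : ℝ) < Fintype.card F := by exact_mod_cast Fintype.card_pos
  have h1 := congrArg norm (bh_eq h2 ψ hψ m)
  rw [norm_mul, norm_mul, norm_pow, gs_norm h2 ψ hψ, Complex.norm_natCast] at h1
  rw [le_div_iff₀ hq0, mul_comm, h1, pow_succ]
  have h3 := tw_bound h2 ψ⁻¹ (inv_ne_one.2 hψ) d ((∑ j, m j ^ 2) / 4)
  have h4 : (0 : ℝ) ≤ √(Fintype.card F : ℝ) ^ d := by positivity
  nlinarith [mul_le_mul_of_nonneg_left h3 h4]

/-- Fourier transform of a real function -/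
noncomputable def ft {F : Type} [Field F] [Fintype F] (ψ : AddChar F ℂ)
    {d : ℕ} (f : (Fin d → F) → ℝ) (m : Fin d → F) : ℂ :=
  ∑ x : Fin d → F, (f x : ℂ) * ψ (∑ j, m j * x j)

lemma dot_sub {F : Type} [Field F] {d : ℕ} (m x y : Fin d → F) :
    ∑ j, m j * (x - y) j = ∑ j, m j * x j - ∑ j, m j * y j := by
  rw [← Finset.sum_sub_distrib]
  apply Finset.sum_congr rfl
  intros; simp; ring

lemma char_conj {F : Type} [Field F] [Fintype F] (ψ : AddChar F ℂ) (a b : F) :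
    ψ (a - b) = ψ a * (starRingEnd ℂ) (ψ b) := by
  rw [sub_eq_add_neg, AddChar.map_add_eq_mul, AddChar.map_neg_eq_conj]

lemma parseval {F : Type} [Field F] [Fintype F] (ψ : AddChar F ℂ) (hψ : ψ ≠ 1)
    {d : ℕ} (f : (Fin d → F) → ℝ) :
    ∑ m, ‖ft ψ f m‖ ^ 2 = (Fintype.card F : ℝ) ^ d * ∑ x, f x ^ 2 := by
  classical
  have h : ((∑ m, ‖ft ψ f m‖ ^ 2 : ℝ) : ℂ) = (((Fintype.card F : ℝ) ^ d * ∑ x, f x ^ 2 : ℝ) : ℂ) := by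
    push_cast
    have h1 : ∀ m, ((‖ft ψ f m‖ : ℂ)) ^ 2 =
        ∑ x, ∑ y, ((f x : ℂ) * f y) * ψ (∑ j, m j * (x - y) j) := by
      intro m
      rw [← Complex.mul_conj', ft, map_sum, Finset.sum_mul_sum]
      apply Finset.sum_congr rfl; intro x _
      apply Finset.sum_congr rfl; intro y _
      rw [dot_sub, char_conj, map_mul, Complex.conj_ofReal]
      ring
    simp_rw [h1]
    rw [Finset.sum_comm, Finset.mul_sum]
    apply Finset.sum_congr rfl; intro x _
    rw [Finset.sum_comm]
    simp_rw [← Finset.mul_sum, dot_ortho ψ hψ, sub_eq_zero]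
    simp
    ring
  exact_mod_cast h

/-- ℓ² norm -/
noncomputable def nm {V : Type} [Fintype V] (f : V → ℝ) : ℝ := √(∑ x, f x ^ 2)

lemma bilin_bound {F : Type} [Field F] [Fintype F] [DecidableEq F] (h2 : ringChar F ≠ 2)
    {d : ℕ} (h f : (Fin d → F) → ℝ) :
    |∑ x, ∑ y, h x * bf (x - y) * f y| ≤
      2 * √(Fintype.card F : ℝ) ^ (d + 1) / Fintype.card F * (nm h * nm f) := by
  obtain ⟨ψ, hψ1⟩ := (AddChar.exists_apply_ne_zero (a := (1 : F))).2 one_ne_zero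
  have hψ : ψ ≠ 1 := AddChar.ne_one_iff.2 ⟨1, hψ1⟩
  have hq0 : (0 : ℝ) < Fintype.card F := by exact_mod_cast Fintype.card_pos
  set μ := 2 * √(Fintype.card F : ℝ) ^ (d + 1) / Fintype.card F with hμ
  have hμ0 : 0 ≤ μ := by positivity
  have hinv : ∀ z : Fin d → F, (Fintype.card F : ℂ) ^ d * bf z =
      ∑ m, bh ψ m * (starRingEnd ℂ) (ψ (∑ j, m j * z j)) := by
    intro z
    simp_rw [bh, Finset.sum_mul]
    rw [Finset.sum_comm]
    simp_rw [mul_assoc, ← char_conj, ← dot_sub, ← Finset.mul_sum, dot_ortho ψ hψ, sub_eq_zero]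
    simp
    ring
  have h1 : (Fintype.card F : ℂ) ^ d * ((∑ x, ∑ y, h x * bf (x - y) * f y : ℝ) : ℂ) =
      ∑ m, bh ψ m * ((starRingEnd ℂ) (ft ψ h m) * ft ψ f m) := by
    push_cast
    have : ∀ m, bh ψ m * ((starRingEnd ℂ) (ft ψ h m) * ft ψ f m) = ∑ x, ∑ y, (h x : ℂ) * f y *
        (bh ψ m * (starRingEnd ℂ) (ψ (∑ j, m j * (x - y) j))) := by
      intro m
      rw [ft, ft, map_sum, Finset.sum_mul_sum, Finset.mul_sum]
      apply Finset.sum_congr rfl; intro x _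
      rw [Finset.mul_sum]
      apply Finset.sum_congr rfl; intro y _
      rw [dot_sub, char_conj, map_mul, map_mul, Complex.conj_ofReal, Complex.conj_conj]
      ring
    simp_rw [this]
    rw [Finset.mul_sum]
    conv_rhs => rw [Finset.sum_comm]
    apply Finset.sum_congr rfl; intro x _
    rw [Finset.mul_sum]
    conv_rhs => rw [Finset.sum_comm]
    apply Finset.sum_congr rfl; intro y _
    rw [← Finset.mul_sum, ← hinv]
    ring
  have hqd : (0 : ℝ) < (Fintype.card F : ℝ) ^ d := by positivity
  have h3 := congrArg norm h1
  rw [norm_mul, norm_pow, Complex.norm_natCast, Complex.norm_real, Real.norm_eq_abs] at h3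
  have h4 : ‖∑ m, bh ψ m * ((starRingEnd ℂ) (ft ψ h m) * ft ψ f m)‖ ≤
      μ * ∑ m, ‖ft ψ h m‖ * ‖ft ψ f m‖ := by
    refine (norm_sum_le _ _).trans ?_
    rw [Finset.mul_sum]
    apply Finset.sum_le_sum
    intro m _
    rw [norm_mul, norm_mul, RCLike.norm_conj]
    gcongr
    exact bh_bound h2 ψ hψ m
  have h5 := Real.sum_mul_le_sqrt_mul_sqrt Finset.univ (fun m => ‖ft ψ h m‖) (fun m => ‖ft ψ f m‖)
  rw [parseval ψ hψ, parseval ψ hψ, Real.sqrt_mul hqd.le, Real.sqrt_mul hqd.le] at h5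
  have h6 : √((Fintype.card F : ℝ) ^ d) * √((Fintype.card F : ℝ) ^ d) = (Fintype.card F : ℝ) ^ d :=
    Real.mul_self_sqrt hqd.le
  have h7 : ∑ m, ‖ft ψ h m‖ * ‖ft ψ f m‖ ≤ (Fintype.card F : ℝ) ^ d * (nm h * nm f) := by
    refine h5.trans (le_of_eq ?_)
    rw [nm, nm]
    calc _ = (√((Fintype.card F : ℝ) ^ d) * √((Fintype.card F : ℝ) ^ d)) *
          (√(∑ x, h x ^ 2) * √(∑ x, f x ^ 2)) := by ring
      _ = _ := by rw [h6]
  have h8 := mul_le_mul_of_nonneg_left h7 hμ0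
  have h9 : (Fintype.card F : ℝ) ^ d * |∑ x, ∑ y, h x * bf (x - y) * f y| ≤
      (Fintype.card F : ℝ) ^ d * (μ * (nm h * nm f)) := by
    rw [h3]; linarith
  exact le_of_mul_le_mul_left h9 hqd

lemma nm_nonneg {V : Type} [Fintype V] (f : V → ℝ) : 0 ≤ nm f := Real.sqrt_nonneg _

lemma nm_sq {V : Type} [Fintype V] (f : V → ℝ) : nm f ^ 2 = ∑ x, f x ^ 2 :=
  Real.sq_sqrt (Finset.sum_nonneg fun _ _ => sq_nonneg _)

lemma nm_eq {V : Type} [Fintype V] (f : V → ℝ) : nm f = ‖(WithLp.toLp 2 f : EuclideanSpace ℝ V)‖ := by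
  rw [EuclideanSpace.norm_eq, nm]
  simp

lemma nm_add {V : Type} [Fintype V] (f g : V → ℝ) : nm (fun x => f x + g x) ≤ nm f + nm g := by
  rw [nm_eq, nm_eq, nm_eq]
  exact norm_add_le (WithLp.toLp 2 f : EuclideanSpace ℝ V) (WithLp.toLp 2 g)

lemma nm_smul {V : Type} [Fintype V] (c : ℝ) (hc : 0 ≤ c) (f : V → ℝ) :
    nm (fun x => c * f x) = c * nm f := by
  rw [nm, nm]
  simp_rw [mul_pow, ← Finset.mul_sum]
  rw [Real.sqrt_mul (sq_nonneg c), Real.sqrt_sq hc]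

lemma inner_le_nm {V : Type} [Fintype V] (f g : V → ℝ) : ∑ x, f x * g x ≤ nm f * nm g :=
  Real.sum_mul_le_sqrt_mul_sqrt Finset.univ f g

section
variable {F : Type} [Field F] [Fintype F] [DecidableEq F] {d : ℕ}

/-- indicator -/
noncomputable def ind (E : Finset (Fin d → F)) (x : Fin d → F) : ℝ := if x ∈ E then 1 else 0

/-- truncated adjacency operator -/
noncomputable def tr (E : Finset (Fin d → F)) (f : (Fin d → F) → ℝ) (x : Fin d → F) : ℝ :=
  ind E x * ∑ y, (if ∑ j, (x j - y j) ^ 2 = 1 then 1 else 0) * f y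

/-- truncated centred operator -/
noncomputable def tb (E : Finset (Fin d → F)) (f : (Fin d → F) → ℝ) (x : Fin d → F) : ℝ :=
  ind E x * ∑ y, bf (x - y) * f y

lemma tr_eq (E : Finset (Fin d → F)) (f : (Fin d → F) → ℝ) (x : Fin d → F) :
    tr E f x = tb E f x + (∑ y, f y) / Fintype.card F * ind E x := by
  rw [tr, tb]
  have : ∑ y, bf (x - y) * f y = ∑ y, (if ∑ j, (x j - y j) ^ 2 = 1 then 1 else 0) * f y -
      (∑ y, f y) / Fintype.card F := by
    rw [Finset.sum_div, ← Finset.sum_sub_distrib]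
    apply Finset.sum_congr rfl
    intro y _
    simp only [bf, Pi.sub_apply]
    ring
  rw [this]; ring

lemma ind_sq (E : Finset (Fin d → F)) (x : Fin d → F) : ind E x * ind E x = ind E x := by
  rw [ind]; split_ifs <;> simp

lemma sum_ind (E : Finset (Fin d → F)) : ∑ x, ind E x = E.card := by
  simp [ind]

lemma nm_ind (E : Finset (Fin d → F)) : nm (ind E) = √(E.card : ℝ) := by
  rw [nm]; simp_rw [pow_two, ind_sq, sum_ind]

lemma tb_bound (h2 : ringChar F ≠ 2) (E : Finset (Fin d → F)) (f : (Fin d → F) → ℝ) :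
    nm (tb E f) ≤ 2 * √(Fintype.card F : ℝ) ^ (d + 1) / Fintype.card F * nm f := by
  have h := bilin_bound h2 (tb E f) f
  have h1 : ∑ x, ∑ y, tb E f x * bf (x - y) * f y = nm (tb E f) ^ 2 := by
    rw [nm_sq]
    apply Finset.sum_congr rfl
    intro x _
    simp_rw [mul_assoc, ← Finset.mul_sum]
    simp only [tb]
    calc _ = (ind E x) * (∑ y, bf (x - y) * f y) ^ 2 := by ring
      _ = (ind E x * ind E x) * (∑ y, bf (x - y) * f y) ^ 2 := by rw [ind_sq]
      _ = _ := by ring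
  rw [h1, abs_of_nonneg (sq_nonneg _)] at h
  rcases (nm_nonneg (tb E f)).eq_or_lt with h0 | h0
  · rw [← h0]
    have := nm_nonneg f
    positivity
  · refine le_of_mul_le_mul_left ?_ h0
    calc _ = nm (tb E f) ^ 2 := by ring
      _ ≤ _ := h
      _ = _ := by ring

lemma tr_bound (h2 : ringChar F ≠ 2) (E : Finset (Fin d → F)) (f : (Fin d → F) → ℝ)
    (hf : ∀ x, f x = ind E x * f x) :
    nm (tr E f) ≤ ((E.card : ℝ) / Fintype.card F +
      2 * √(Fintype.card F : ℝ) ^ (d + 1) / Fintype.card F) * nm f := by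
  have h1 : tr E f = fun x => tb E f x + (∑ y, f y) / Fintype.card F * ind E x := by
    funext x; exact tr_eq E f x
  have h3 : nm (fun x => (∑ y, f y) / Fintype.card F * ind E x) ≤
      (E.card : ℝ) / Fintype.card F * nm f := by
    have hq0 : (0 : ℝ) < Fintype.card F := by exact_mod_cast Fintype.card_pos
    have h4 : |∑ y, f y| ≤ √(E.card : ℝ) * nm f := by
      rw [← nm_ind]
      have h5 : ∑ y, f y = ∑ y, ind E y * f y := Finset.sum_congr rfl fun x _ => hf x
      rw [abs_le']
      refine ⟨h5 ▸ inner_le_nm _ _, ?_⟩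
      have h6 := inner_le_nm (ind E) (fun x => - f x)
      have h7 : nm (fun x => - f x) = nm f := by simp [nm]
      rw [h7] at h6
      simp only [mul_neg, Finset.sum_neg_distrib] at h6
      rw [h5]; exact h6
    have h8 : nm (fun x => (∑ y, f y) / Fintype.card F * ind E x) =
        |∑ y, f y| / Fintype.card F * √(E.card : ℝ) := by
      rw [← nm_ind, ← nm_smul _ (by positivity), nm, nm]
      simp only [mul_pow, div_pow, sq_abs]
    clear hf
    rw [h8]
    calc _ ≤ √(E.card : ℝ) * nm f / Fintype.card F * √(E.card : ℝ) := by gcongr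
      _ = (√(E.card : ℝ) * √(E.card : ℝ)) / Fintype.card F * nm f := by ring
      _ = _ := by rw [Real.mul_self_sqrt (by positivity)]
  rw [h1]
  refine (nm_add _ _).trans ?_
  have := tb_bound h2 E f
  linarith

/-- weighted chains -/
noncomputable def wk (E : Finset (Fin d → F)) : ℕ → (Fin d → F) → ℝ
  | 0 => ind E
  | k + 1 => tr E (wk E k)

lemma wk_supp (E : Finset (Fin d → F)) (k : ℕ) (x : Fin d → F) : wk E k x = ind E x * wk E k x := by
  cases k with
  | zero => simp only [wk]; rw [ind_sq]
  | succ k => simp only [wk, tr]; rw [← mul_assoc, ind_sq]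

lemma err_bound (h2 : ringChar F ≠ 2) (E : Finset (Fin d → F)) (X μ : ℝ)
    (hX : X = (E.card : ℝ) / Fintype.card F)
    (hμ : μ = 2 * √(Fintype.card F : ℝ) ^ (d + 1) / Fintype.card F) (k : ℕ) :
    nm (fun x => wk E k x + - (X ^ k * ind E x)) ≤ ((X + μ) ^ k - X ^ k) * √(E.card : ℝ) := by
  have hX0 : 0 ≤ X := by rw [hX]; positivity
  have hμ0 : 0 ≤ μ := by rw [hμ]; positivity
  induction k with
  | zero => simp [wk, nm]
  | succ k ih =>
    have e : (fun x => wk E (k + 1) x + - (X ^ (k + 1) * ind E x)) = fun x =>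
        tr E (fun x => wk E k x + - (X ^ k * ind E x)) x + X ^ k * tb E (ind E) x := by
      funext x
      have h1 : tb E (ind E) x = tr E (ind E) x - X * ind E x := by
        rw [tr_eq, sum_ind, hX]; ring
      have h3 : tr E (fun x => wk E k x + - (X ^ k * ind E x)) x =
          tr E (wk E k) x - X ^ k * tr E (ind E) x := by
        simp only [tr, mul_add, Finset.sum_add_distrib, Finset.mul_sum, sub_eq_add_neg,
          ← Finset.sum_neg_distrib]
        congr 1
        apply Finset.sum_congr rfl
        intro y _
        ring
      rw [h3, h1, wk]; ring
    rw [e]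
    refine (nm_add _ _).trans ?_
    rw [nm_smul _ (by positivity)]
    have b1 := tr_bound h2 E (fun x => wk E k x + - (X ^ k * ind E x)) (by
      intro x
      rw [mul_add, ← wk_supp]
      have := ind_sq E x
      linear_combination (X ^ k) * this)
    have b2 := tb_bound h2 E (ind E)
    rw [← hX, ← hμ] at b1
    rw [← hμ, nm_ind] at b2
    have b3 := mul_le_mul_of_nonneg_left ih (add_nonneg hX0 hμ0)
    have b4 := mul_le_mul_of_nonneg_left b2 (pow_nonneg hX0 k)
    calc _ ≤ (X + μ) * (((X + μ) ^ k - X ^ k) * √(E.card : ℝ)) + X ^ k * (μ * √(E.card : ℝ)) := by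
          linarith
      _ = _ := by ring

lemma sum_wk_ge (h2 : ringChar F ≠ 2) (E : Finset (Fin d → F)) (X μ : ℝ)
    (hX : X = (E.card : ℝ) / Fintype.card F)
    (hμ : μ = 2 * √(Fintype.card F : ℝ) ^ (d + 1) / Fintype.card F) (k : ℕ) :
    E.card * (X ^ k - ((X + μ) ^ k - X ^ k)) ≤ ∑ x, wk E k x := by
  have h1 := err_bound h2 E X μ hX hμ k
  have h3 := inner_le_nm (ind E) (fun x => - (wk E k x + - (X ^ k * ind E x)))
  have h7 : nm (fun x => - (wk E k x + - (X ^ k * ind E x))) =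
    nm (fun x => (wk E k x + - (X ^ k * ind E x))) := by simp only [nm, neg_sq]
  rw [h7, nm_ind] at h3
  have h4 : ∑ x, ind E x * - (wk E k x + - (X ^ k * ind E x)) = X ^ k * E.card - ∑ x, wk E k x := by
    rw [← sum_ind, Finset.mul_sum, ← Finset.sum_sub_distrib]
    apply Finset.sum_congr rfl
    intro x _
    have a1 := wk_supp E k x
    have a2 := ind_sq E x
    linear_combination X ^ k * a2 + a1
  have h5 := mul_le_mul_of_nonneg_left h1 (Real.sqrt_nonneg (E.card : ℝ))
  have h6 : √(E.card : ℝ) * √(E.card : ℝ) = E.card := Real.mul_self_sqrt (by positivity)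
  have h8 : √(E.card : ℝ) * (((X + μ) ^ k - X ^ k) * √(E.card : ℝ)) =
      E.card * ((X + μ) ^ k - X ^ k) := by
    rw [← h6]; ring_nf; rw [Real.sqrt_sq (Real.sqrt_nonneg _)]
  rw [h8] at h5
  rw [h4] at h3
  linarith

/-- chain predicate -/
def isCh (E : Finset (Fin d → F)) (n : ℕ) (x : Fin (n + 1) → (Fin d → F)) : Prop :=
  (∀ i, x i ∈ E) ∧ ∀ i : Fin n, ∑ j, (x i.castSucc j - x i.succ j) ^ 2 = 1

lemma isCh_cons (E : Finset (Fin d → F)) (n : ℕ) (a b : Fin d → F) (t : Fin n → (Fin d → F)) :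
    isCh E (n + 1) (Fin.cons a (Fin.cons b t : Fin (n + 1) → (Fin d → F))) ↔
      a ∈ E ∧ (∑ j, (a j - b j) ^ 2 = 1) ∧ isCh E n (Fin.cons b t) := by
  unfold isCh
  have e1 : (∀ i, (Fin.cons a (Fin.cons b t : Fin (n + 1) → (Fin d → F)) :
      Fin (n + 2) → (Fin d → F)) i ∈ E) ↔
      a ∈ E ∧ ∀ i, (Fin.cons b t : Fin (n + 1) → (Fin d → F)) i ∈ E := by
    rw [Fin.forall_fin_succ]
    simp only [Fin.cons_zero, Fin.cons_succ]
  have e2 : (∀ i : Fin (n + 1), ∑ j, ((Fin.cons a (Fin.cons b t : Fin (n + 1) → (Fin d → F)) :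
      Fin (n + 2) → (Fin d → F)) i.castSucc j - (Fin.cons a (Fin.cons b t :
      Fin (n + 1) → (Fin d → F)) : Fin (n + 2) → (Fin d → F)) i.succ j) ^ 2 = 1) ↔
      (∑ j, (a j - b j) ^ 2 = 1) ∧ ∀ i : Fin n,
        ∑ j, ((Fin.cons b t : Fin (n + 1) → (Fin d → F)) i.castSucc j -
          (Fin.cons b t : Fin (n + 1) → (Fin d → F)) i.succ j) ^ 2 = 1 := by
    rw [Fin.forall_fin_succ]
    simp only [Fin.cons_zero, Fin.cons_succ, Fin.castSucc_zero, ← Fin.succ_castSucc]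
  rw [e1, e2]
  tauto

open Classical in
lemma wk_eq (E : Finset (Fin d → F)) (n : ℕ) (a : Fin d → F) :
    wk E n a = ∑ t : Fin n → (Fin d → F), if isCh E n (Fin.cons a t) then 1 else 0 := by
  induction n generalizing a with
  | zero => simp [wk, ind, isCh]
  | succ n ih =>
    rw [wk, tr, ← (Fin.consEquiv (fun _ : Fin (n + 1) => (Fin d → F))).sum_comp, Fintype.sum_prod_type,
      Finset.mul_sum]
    apply Finset.sum_congr rfl
    intro b _
    rw [ih, Finset.mul_sum, Finset.mul_sum]
    apply Finset.sum_congr rfl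
    intro t _
    simp only [Fin.consEquiv, Equiv.coe_fn_mk, isCh_cons, ind]
    by_cases h1 : a ∈ E <;> by_cases h3 : ∑ j, (a j - b j) ^ 2 = 1 <;> simp [h1, h3]

lemma chainCount_eq (E : Finset (Fin d → F)) (n : ℕ) :
    (chainCount E n : ℝ) = ∑ x, wk E n x := by
  classical
  simp_rw [wk_eq]
  rw [← Fintype.sum_prod_type', chainCount, Finset.card_filter, Nat.cast_sum,
    ← (Fin.consEquiv (fun _ : Fin (n + 1) => (Fin d → F))).sum_comp]
  apply Finset.sum_congr rfl
  intro t _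
  simp only [Fin.consEquiv, Equiv.coe_fn_mk, isCh]
  split_ifs <;> simp

end

lemma exp_sub_le (t : ℝ) (h0 : 0 ≤ t) (h1 : t ≤ Real.log 2) : Real.exp t - 1 ≤ t / Real.log 2 := by
  have hl : 0 < Real.log 2 := Real.log_pos (by norm_num)
  have h := convexOn_exp.2 (Set.mem_univ (0 : ℝ)) (Set.mem_univ (Real.log 2))
    (show 0 ≤ 1 - t / Real.log 2 by rw [sub_nonneg, div_le_one hl]; exact h1)
    (show 0 ≤ t / Real.log 2 by positivity) (by ring)
  simp only [smul_eq_mul, mul_zero, zero_add, Real.exp_zero, mul_one] at h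
  rw [div_mul_cancel₀ _ hl.ne', Real.exp_log (by norm_num)] at h
  linarith

lemma pow_err (X μ : ℝ) (n : ℕ) (hX : 0 < X) (hμ : 0 ≤ μ) (h : n / Real.log 2 * μ ≤ X) :
    (X + μ) ^ n - X ^ n ≤ X ^ n * (n / Real.log 2 * μ / X) := by
  have hl : 0 < Real.log 2 := Real.log_pos (by norm_num)
  have h1 : 1 + μ / X ≤ Real.exp (μ / X) := by linarith [Real.add_one_le_exp (μ / X)]
  have h2 : (1 + μ / X) ^ n ≤ Real.exp (n * (μ / X)) := by
    rw [Real.exp_nat_mul]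
    exact pow_le_pow_left₀ (by positivity) h1 n
  have h3 : (n * (μ / X) : ℝ) ≤ Real.log 2 := by
    rw [div_mul_eq_mul_div, div_le_iff₀ hl] at h
    rw [← mul_div_assoc, div_le_iff₀ hX]; linarith
  have h4 := exp_sub_le _ (by positivity) h3
  have h5 : (X + μ) ^ n = X ^ n * (1 + μ / X) ^ n := by
    rw [← mul_pow]; congr 1; field_simp
  have h6 : n / Real.log 2 * μ / X = n * (μ / X) / Real.log 2 := by ring
  rw [h5, h6]
  have h7 : 0 < X ^ n := by positivity
  nlinarith [mul_le_mul_of_nonneg_left (h2.trans (by linarith : Real.exp (n * (μ / X)) ≤ 1 + n * (μ / X) / Real.log 2)) h7.le]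

theorem statement11 {F : Type} [Field F] [Fintype F] [DecidableEq F]
    (q : ℕ) (hq : Fintype.card F = q) (hodd : Odd q)
    (d : ℕ) (hd : 2 ≤ d)
    (E : Finset (Fin d → F)) (n : ℕ)
    (hE : (2 * (n : ℝ) / Real.log 2) * (q : ℝ) ^ (((d : ℝ) + 1) / 2) < (E.card : ℝ)) :
    (E.card : ℝ) ^ (n + 1) / (q : ℝ) ^ n -
        (2 * (n : ℝ) / Real.log 2) * (q : ℝ) ^ (((d : ℝ) + 1) / 2) *
          ((E.card : ℝ) ^ n / (q : ℝ) ^ n) ≤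
      (chainCount E n : ℝ) := by
  have h2 : ringChar F ≠ 2 := by
    intro h
    have := FiniteField.even_card_of_char_two h
    rw [hq] at this
    rw [Nat.odd_iff] at hodd
    omega
  have hl : 0 < Real.log 2 := Real.log_pos (by norm_num)
  have hq0 : (0 : ℝ) < q := by rw [← hq]; exact_mod_cast Fintype.card_pos
  have hs : (q : ℝ) ^ (((d : ℝ) + 1) / 2) = √(q : ℝ) ^ (d + 1) := by
    rw [Real.sqrt_eq_rpow, ← Real.rpow_natCast, ← Real.rpow_mul hq0.le]
    congr 1; push_cast; ring
  rw [hs] at hE ⊢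
  set S := √(q : ℝ) ^ (d + 1) with hS
  have hS0 : 0 ≤ S := by positivity
  have hE0 : (0 : ℝ) < E.card := lt_of_le_of_lt (by positivity) hE
  have h3 := sum_wk_ge h2 E ((E.card : ℝ) / q) (2 * S / q) (by rw [hq]) (by rw [hq]) n
  rw [← chainCount_eq] at h3
  have h4 := pow_err ((E.card : ℝ) / q) (2 * S / q) n (by positivity) (by positivity) (by
    rw [← mul_div_assoc]
    gcongr
    refine le_of_eq_of_le ?_ hE.le
    ring)
  have h5 := mul_le_mul_of_nonneg_left h4 hE0.le
  refine le_trans ?_ h3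
  rw [mul_sub]
  refine le_trans (le_of_eq ?_) (sub_le_sub_left h5 _)
  rw [div_pow]
  field_simp
  ring
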